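/- arXiv:2311.02914 — 6 statements merged into one kernel-verified Lean document; each statement's English description precedes it below -/
import Mathlib

section
/- Let D be an integer with D ≥ 3292872, and let H be a finite multigraph given by a finite vertex set V and a symmetric function μ : V × V → ℕ with μ(v,v) = 0 for all v; write d(v) = Σ_{u∈V} μ(v,u) and let m be the number of edges, so 2m = Σ_{(u,v)∈V×V} μ(u,v), and let N(v) = {u : μ(u,v) ≥ 1}. Assume: (i) d(v) ≤ D for every v ∈ V; (ii) d(v) ≥ 1 for every v ∈ V; (iii) 2m > 5D − 120; and (iv) for all adjacent u,v (μ(u,v) ≥ 1), m − (d(u) + d(v) − μ(u,v)) ≤ D − 2, i.e., every edge shares an endpoint with all but at most D − 2 edges. Then for every v ∈ V: |N(v)| ≥ 2, and (|N(v)| − 1)·d(v) ≥ |N(v)|·(m − 2D + 2). -/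
open scoped Classical
open Finset

theorem multigraph_neighbor_degree_bounds (D : ℕ) (hD : 3292872 ≤ D)
    {V : Type*} [Fintype V] (μ : V → V → ℕ)
    (hsymm : ∀ u v, μ u v = μ v u) (hloop : ∀ v, μ v v = 0)
    (m : ℕ) (hm : 2 * m = ∑ u, ∑ v, μ u v)
    -- (i) every vertex has degree at most D
    (hdegD : ∀ v, ∑ u, μ v u ≤ D)
    -- (ii) every vertex has degree at least 1
    (hdeg1 : ∀ v, 1 ≤ ∑ u, μ v u)
    -- (iii) 2m > 5D − 120
    (hm_lb : 5 * D < 2 * m + 120)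
    -- (iv) every edge shares an endpoint with all but at most D − 2 edges:
    -- m − (d(u) + d(v) − μ(u,v)) ≤ D − 2
    (hshare : ∀ u v, 1 ≤ μ u v →
      m + μ u v + 2 ≤ D + ((∑ w, μ u w) + (∑ w, μ v w))) :
    ∀ v : V,
      2 ≤ (univ.filter (fun u => 1 ≤ μ u v)).card ∧
      (univ.filter (fun u => 1 ≤ μ u v)).card * (m + 2) ≤
        ((univ.filter (fun u => 1 ≤ μ u v)).card - 1) * (∑ u, μ v u) +
          (univ.filter (fun u => 1 ≤ μ u v)).card * (2 * D) := by
  intro v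
  set N := univ.filter (fun u => 1 ≤ μ u v)
  have hsum : ∑ u ∈ N, μ u v = ∑ u, μ v u := by
    rw [Finset.sum_filter_of_ne fun u _ h => Nat.one_le_iff_ne_zero.mpr h]
    exact Finset.sum_congr rfl fun u _ => hsymm u v
  have hcard : 1 ≤ N.card := by
    by_contra! h
    have hN : N = ∅ := Finset.card_eq_zero.mp (by omega)
    have := hdeg1 v
    simp [← hsum, hN] at this
  -- Sum the edge condition over the neighbors of `v`, bounding their degrees by `D`.
  have key : ∑ u ∈ N, (μ u v + (m + 2)) ≤ ∑ _u ∈ N, (2 * D + ∑ w, μ v w) := by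
    refine Finset.sum_le_sum fun u hu => ?_
    have := hshare u v (Finset.mem_filter.mp hu).2
    have := hdegD u
    omega
  rw [Finset.sum_add_distrib, hsum, Finset.sum_const, Finset.sum_const, smul_eq_mul,
    smul_eq_mul] at key
  obtain ⟨k, hk⟩ := Nat.exists_eq_add_of_le' hcard
  rw [hk] at key ⊢
  have bound : (k + 1) * (m + 2) ≤ k * (∑ u, μ v u) + (k + 1) * (2 * D) := by linarith
  refine ⟨?_, by simpa using bound⟩
  rcases k with _ | k
  · simp only [zero_add, one_mul, zero_mul] at bound
    omega
  · omega
end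

section
/- Let D be a positive integer and let H be a finite multigraph given by a finite vertex set V and a symmetric function μ : V × V → ℕ with μ(v,v) = 0 for all v; write d(v) = Σ_{u∈V} μ(v,u) and let m be the number of edges (2m = Σ_{(u,v)∈V×V} μ(u,v)). Assume that for all adjacent u,v (μ(u,v) ≥ 1), m − (d(u) + d(v) − μ(u,v)) ≤ D − 2. If v, w, x, y ∈ V are four distinct vertices with μ(v,w) ≥ 1 and μ(x,y) ≥ 1, then μ(v,x) + μ(v,y) + μ(w,x) + μ(w,y) + 2D ≥ m + 2 (i.e., μ(v,x)+μ(v,y)+μ(w,x)+μ(w,y) ≥ m − 2D + 2). -/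
open scoped Classical
open Finset

/-- The degrees in a vertex set `S` sum to at most the number of edges plus the number of edges
inside `S` (both sides doubled). -/
theorem two_mul_sum_degree_le {V : Type*} [Fintype V] (μ : V → V → ℕ)
    (hsymm : ∀ u v, μ u v = μ v u) (S : Finset V) :
    2 * ∑ u ∈ S, ∑ z, μ u z ≤ (∑ u, ∑ z, μ u z) + ∑ u ∈ S, ∑ z ∈ S, μ u z := by
  have hcol : ∑ u, ∑ z ∈ S, μ u z = ∑ u ∈ S, ∑ z, μ u z := by
    rw [Finset.sum_comm]
    exact Finset.sum_congr rfl fun u _ => Finset.sum_congr rfl fun z _ => hsymm z u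
  have hsplit := Finset.sum_add_sum_compl S fun u => ∑ z, μ u z
  have hsplit' := Finset.sum_add_sum_compl S fun u => ∑ z ∈ S, μ u z
  have hle : ∑ u ∈ Sᶜ, ∑ z ∈ S, μ u z ≤ ∑ u ∈ Sᶜ, ∑ z, μ u z :=
    Finset.sum_le_sum fun u _ =>
      Finset.sum_le_sum_of_subset (Finset.subset_univ S)
  omega

theorem multigraph_disjoint_edges_multiplicity_sum (D : ℕ) (hD : 0 < D)
    {V : Type*} [Fintype V] (μ : V → V → ℕ)
    (hsymm : ∀ u v, μ u v = μ v u) (hloop : ∀ v, μ v v = 0)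
    (m : ℕ) (hm : 2 * m = ∑ u, ∑ v, μ u v)
    -- for all adjacent u, v: m − (d(u) + d(v) − μ(u,v)) ≤ D − 2
    (hshare : ∀ u v, 1 ≤ μ u v →
      m + μ u v + 2 ≤ D + ((∑ w, μ u w) + (∑ w, μ v w)))
    (v w x y : V) (hvw : v ≠ w) (hvx : v ≠ x) (hvy : v ≠ y)
    (hwx : w ≠ x) (hwy : w ≠ y) (hxy : x ≠ y)
    (hevw : 1 ≤ μ v w) (hexy : 1 ≤ μ x y) :
    m + 2 ≤ μ v x + μ v y + μ w x + μ w y + 2 * D := by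
  have hvertex (f : V → ℕ) : ∑ u ∈ {v, w, x, y}, f u = f v + (f w + (f x + f y)) := by
    rw [Finset.sum_insert (by simp [hvw, hvx, hvy]), Finset.sum_insert (by simp [hwx, hwy]),
      Finset.sum_pair hxy]
  have hdeg := two_mul_sum_degree_le μ hsymm {v, w, x, y}
  simp only [hvertex, hloop, ← hm] at hdeg
  have h₁ := hshare v w hevw
  have h₂ := hshare x y hexy
  rw [hsymm w v, hsymm x v, hsymm y v, hsymm x w, hsymm y w, hsymm y x] at hdeg
  omega
end

section
/- Let D be an integer with D ≥ 3292872, and let H be a finite multigraph given by a finite vertex set V and a symmetric function μ : V × V → ℕ with μ(v,v) = 0 for all v; write d(v) = Σ_{u∈V} μ(v,u) and let m be the number of edges (2m = Σ_{(u,v)∈V×V} μ(u,v)). Assume: (i) d(v) ≤ D for every v ∈ V; (ii) 2·d(v) ≥ D − 114 for every v ∈ V; (iii) 5D − 120 < 2m ≤ 5D; and (iv) for all adjacent u,v (μ(u,v) ≥ 1), m − (d(u) + d(v) − μ(u,v)) ≤ D − 2. Then the underlying simple graph of H (vertices V, adjacency μ(u,v) ≥ 1) is connected, and 5 ≤ |V|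 ≤ 6. -/
open scoped Classical
open Finset

/-- In a loopless multigraph, the degree sum over a set `S` closed under adjacency counts at least
twice every edge meeting `{u, v}`, for any distinct `u`, `v` in `S`. -/
lemma two_mul_degree_add_degree_le_sum_of_closed {V : Type*} [Fintype V] (μ : V → V → ℕ)
    (hsymm : ∀ u v, μ u v = μ v u) (hloop : ∀ v, μ v v = 0) (S : Finset V)
    (hS : ∀ u ∈ S, ∀ v, 1 ≤ μ u v → v ∈ S) {u v : V} (hu : u ∈ S) (hv : v ∈ S) (huv : u ≠ v) :
    2 * (∑ w, μ u w + ∑ w, μ v w) ≤ ∑ w ∈ S, ∑ x, μ w x + 2 * μ u v := by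
  have hdeg : ∀ a ∈ S, ∑ w ∈ S, μ w a = ∑ w, μ a w := by
    intro a ha
    simp_rw [hsymm _ a]
    refine sum_subset (subset_univ S) fun x _ hx => ?_
    by_contra h
    exact hx (hS a ha x (Nat.one_le_iff_ne_zero.mpr h))
  have hpoint : ∀ w ∈ S, μ w u + μ w v + (if w = u then ∑ x, μ u x else 0)
      + (if w = v then ∑ x, μ v x else 0)
      ≤ ∑ x, μ w x + (if w = u then μ u v else 0) + (if w = v then μ u v else 0) := by
    intro w _
    by_cases h₁ : w = u
    · subst h₁
      simp [huv, hloop]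
      omega
    · by_cases h₂ : w = v
      · subst h₂
        simp [h₁, hloop, hsymm w u]
        omega
      · have := sum_le_sum_of_subset (f := fun x => μ w x) (subset_univ ({u, v} : Finset V))
        rw [sum_pair huv] at this
        simpa [h₁, h₂] using this
  have hsum := sum_le_sum hpoint
  simp only [sum_add_distrib, sum_ite_eq', hu, hv, if_true, hdeg u hu, hdeg v hv] at hsum
  omega

/-- If every edge of a multigraph with `m` edges meets at least `k` edges (itself included), then
`m * k` is at most the sum of the squared degrees minus half the sum of the squared
multiplicities. -/
lemma two_mul_edges_mul_le_sum_sq_degree {V : Type*} [Fintype V] (μ : V → V → ℤ)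
    (hsymm : ∀ u v, μ u v = μ v u) (hnonneg : ∀ u v, 0 ≤ μ u v) (k : ℤ)
    (hk : ∀ u v, 1 ≤ μ u v → k ≤ ∑ w, μ u w + ∑ w, μ v w - μ u v) :
    (∑ u, ∑ v, μ u v) * k + ∑ u, ∑ v, μ u v ^ 2 ≤ 2 * ∑ u, (∑ v, μ u v) ^ 2 := by
  have h₁ : ∑ u, ∑ v, (μ u v * k + μ u v ^ 2)
      ≤ ∑ u, ∑ v, (μ u v * ∑ w, μ u w + μ u v * ∑ w, μ v w) := by
    refine sum_le_sum fun u _ => sum_le_sum fun v _ => ?_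
    rcases (hnonneg u v).eq_or_lt with h | h
    · simp [← h]
    · nlinarith [hk u v h]
  have h₂ : ∑ u, ∑ v, μ u v * ∑ w, μ v w = ∑ u, ∑ v, μ u v * ∑ w, μ u w := by
    rw [sum_comm]
    simp_rw [hsymm]
  simp only [sum_add_distrib, h₂] at h₁
  simp only [← sum_mul] at h₁
  simp only [pow_two (∑ v, μ _ v)]
  linarith

theorem multigraph_connected_and_order_between_five_and_six (D : ℕ) (hD : 3292872 ≤ D)
    {V : Type*} [Fintype V] (μ : V → V → ℕ)
    (hsymm : ∀ u v, μ u v = μ v u) (hloop : ∀ v, μ v v = 0)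
    (m : ℕ) (hm : 2 * m = ∑ u, ∑ v, μ u v)
    -- (i) every vertex has degree at most D
    (hdegD : ∀ v, ∑ u, μ v u ≤ D)
    -- (ii) 2·d(v) ≥ D − 114 for every v
    (hdeg_lb : ∀ v, D ≤ 2 * (∑ u, μ v u) + 114)
    -- (iii) 5D − 120 < 2m ≤ 5D
    (hm_lb : 5 * D < 2 * m + 120) (hm_ub : 2 * m ≤ 5 * D)
    -- (iv) m − (d(u) + d(v) − μ(u,v)) ≤ D − 2 for all adjacent u, v
    (hshare : ∀ u v, 1 ≤ μ u v →
      m + μ u v + 2 ≤ D + ((∑ w, μ u w) + (∑ w, μ v w))) :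
    (SimpleGraph.fromRel (fun u v => 1 ≤ μ u v)).Connected ∧
      5 ≤ Fintype.card V ∧ Fintype.card V ≤ 6 := by
  have hne : ∀ u v, 1 ≤ μ u v → u ≠ v := by
    rintro u _ h rfl
    simp [hloop] at h
  have hcard : 5 ≤ Fintype.card V := by
    have h := sum_le_card_nsmul univ (fun v => ∑ u, μ v u) D fun v _ => hdegD v
    rw [← hm, card_univ, smul_eq_mul] at h
    by_contra! hlt
    have : Fintype.card V * D ≤ 4 * D := Nat.mul_le_mul_right D (by omega)
    omega
  have hclosed : ∀ S : Finset V, S.Nonempty → (∀ u ∈ S, ∀ v, 1 ≤ μ u v → v ∈ S) →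
      2 * (m + 2) ≤ ∑ w ∈ S, ∑ x, μ w x + 2 * D := by
    rintro S ⟨u, hu⟩ hS
    obtain ⟨v, -, hv⟩ : ∃ v ∈ univ, μ u v ≠ 0 := by
      refine exists_ne_zero_of_sum_ne_zero ?_
      have := hdeg_lb u
      omega
    have huv : 1 ≤ μ u v := Nat.one_le_iff_ne_zero.mpr hv
    have h₁ := two_mul_degree_add_degree_le_sum_of_closed μ hsymm hloop S hS hu (hS u hu v huv)
      (hne u v huv)
    have h₂ := hshare u v huv
    omega
  refine ⟨?_, hcard, ?_⟩
  · have : Nonempty V := Fintype.card_pos_iff.mp (by omega)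
    refine ⟨fun a b => ?_⟩
    by_contra hab
    set G := SimpleGraph.fromRel (fun u v => 1 ≤ μ u v)
    have hadj : ∀ u v, 1 ≤ μ u v → G.Adj u v := fun u v h =>
      (SimpleGraph.fromRel_adj _ u v).mpr ⟨hne u v h, Or.inl h⟩
    set S : Finset V := univ.filter (G.Reachable a) with hS
    have h₁ := hclosed S ⟨a, by simp [hS]⟩ fun u hu v huv => by
      simp only [hS, mem_filter_univ] at hu ⊢
      exact hu.trans (hadj u v huv).reachable
    have h₂ := hclosed Sᶜ ⟨b, by simpa [hS] using hab⟩ fun u hu v huv => by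
      simp only [hS, mem_compl, mem_filter_univ] at hu ⊢
      exact fun h => hu (h.trans (hadj u v huv).symm.reachable)
    have h₃ := sum_add_sum_compl S fun w => ∑ x, μ w x
    omega
  · by_contra! hlt
    have hmZ : (2 * m : ℤ) = ∑ u, ∑ v, (μ u v : ℤ) := by exact_mod_cast hm
    have hedges := two_mul_edges_mul_le_sum_sq_degree (fun u v => (μ u v : ℤ))
      (fun u v => by simp only [hsymm u v]) (fun u v => by positivity) (m + 2 - D) fun u v h => by
        have := hshare u v (by exact_mod_cast h)
        zify at this
        linarith
    have hdegsq : 2 * ∑ u, (∑ v, (μ u v : ℤ)) ^ 2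
        ≤ (3 * D - 114) * (2 * m) - Fintype.card V * (D * (D - 114)) := by
      have h : ∑ u, 2 * (∑ v, (μ u v : ℤ)) ^ 2
          ≤ ∑ u, ((3 * D - 114) * (∑ v, (μ u v : ℤ)) - (D * (D - 114) : ℤ)) := by
        refine sum_le_sum fun u _ => ?_
        have h₁ : ∑ v, (μ u v : ℤ) ≤ D := by exact_mod_cast hdegD u
        have h₂ : (D : ℤ) ≤ 2 * ∑ v, (μ u v : ℤ) + 114 := by exact_mod_cast hdeg_lb u
        nlinarith [mul_nonneg (sub_nonneg.mpr h₁) (sub_nonneg.mpr h₂)]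
      rw [← mul_sum, sum_sub_distrib, ← mul_sum, ← hmZ] at h
      simpa using h
    rw [← hmZ] at hedges
    have hD' : (3292872 : ℤ) ≤ D := by exact_mod_cast hD
    have hlb : (5 * D : ℤ) < 2 * m + 120 := by exact_mod_cast hm_lb
    have hub : (2 * m : ℤ) ≤ 5 * D := by exact_mod_cast hm_ub
    have hprod : (5 * D - 120 : ℤ) * (3 * D - 116) ≤ 2 * (2 * m * (m + 2 - D)) := by
      nlinarith [mul_nonneg (by linarith : (0 : ℤ) ≤ 2 * m - (5 * D - 120))
        (by linarith : (0 : ℤ) ≤ 2 * m + 3 * D)]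
    have hdegm : (3 * D - 114 : ℤ) * (2 * m) ≤ (3 * D - 114) * (5 * D) :=
      mul_le_mul_of_nonneg_left hub (by linarith)
    have hsq : ∀ u v : V, 0 ≤ (μ u v : ℤ) ^ 2 := fun u v => sq_nonneg _
    rcases Nat.lt_or_ge 7 (Fintype.card V) with h8 | h7
    · have hT : 0 ≤ ∑ u, ∑ v, (μ u v : ℤ) ^ 2 :=
        sum_nonneg fun u _ => sum_nonneg fun v _ => hsq u v
      have hn : (8 : ℤ) * (D * (D - 114)) ≤ Fintype.card V * (D * (D - 114)) :=
        mul_le_mul_of_nonneg_right (by exact_mod_cast h8) (by nlinarith)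
      nlinarith
    · have hn : Fintype.card V = 7 := by omega
      have hCS : (2 * m : ℤ) ^ 2 ≤ 49 * ∑ u, ∑ v, (μ u v : ℤ) ^ 2 := by
        have h := sq_sum_le_card_mul_sum_sq (s := (univ : Finset (V × V)))
          (f := fun p => (μ p.1 p.2 : ℤ))
        rw [Fintype.sum_prod_type, Fintype.sum_prod_type, ← hmZ, card_univ, Fintype.card_prod,
          hn] at h
        exact_mod_cast h
      have hm_sq : (5 * D - 120 : ℤ) ^ 2 ≤ (2 * m) ^ 2 :=
        pow_le_pow_left₀ (by linarith) (by linarith) 2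
      rw [hn] at hdegsq
      push_cast at hdegsq
      nlinarith
end

section
/- Let D be an integer with D ≥ 3292872, and let H be a finite multigraph given by a vertex set V with |V| = 6 and a symmetric function μ : V × V → ℕ with μ(v,v) = 0 for all v; write d(v) = Σ_{u∈V} μ(v,u) and let m be the number of edges (2m = Σ_{(u,v)∈V×V} μ(u,v)). Assume: (i) d(v) ≤ D for every v ∈ V; (ii) 5D − 120 < 2m ≤ 5D; (iii) μ(u,v) ≥ 1 for all distinct u,v ∈ V (the underlying simple graph is complete); and (iv) for all distinct u,v, m − (d(u) + d(v) − μ(u,v)) ≤ D − 2. Then for every vertex v ∈ V: 3·d(v) ≥ 3m − 5D + 10 and 3·d(v) ≤ 25D − 9m − 50. -/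
open scoped Classical
open Finset

theorem multigraph_complete_degree_bounds (D : ℕ) (hD : 3292872 ≤ D)
    {V : Type*} [Fintype V] (hV : Fintype.card V = 6) (μ : V → V → ℕ)
    (hsymm : ∀ u v, μ u v = μ v u) (hloop : ∀ v, μ v v = 0)
    (m : ℕ) (hm : 2 * m = ∑ u, ∑ v, μ u v)
    -- (i) every vertex has degree at most D
    (hdegD : ∀ v, ∑ u, μ v u ≤ D)
    -- (ii) 5D − 120 < 2m ≤ 5D
    (hm_lb : 5 * D < 2 * m + 120) (hm_ub : 2 * m ≤ 5 * D)
    -- (iii) the underlying simple graph is complete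
    (hcomplete : ∀ u v : V, u ≠ v → 1 ≤ μ u v)
    -- (iv) m − (d(u) + d(v) − μ(u,v)) ≤ D − 2 for all distinct u, v
    (hshare : ∀ u v : V, u ≠ v →
      m + μ u v + 2 ≤ D + ((∑ w, μ u w) + (∑ w, μ v w))) :
    ∀ v : V,
      -- 3·d(v) ≥ 3m − 5D + 10
      3 * m + 10 ≤ 3 * (∑ u, μ v u) + 5 * D ∧
      -- 3·d(v) ≤ 25D − 9m − 50
      3 * (∑ u, μ v u) + 9 * m + 50 ≤ 25 * D := by
  have sum_others (f : V → ℕ) (v : V) : ∑ u ∈ univ.erase v, f u + f v = ∑ u, f u :=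
    sum_erase_add _ _ (mem_univ v)
  have card_others (v : V) : #(univ.erase v) = 5 := by
    rw [card_erase_of_mem (mem_univ v), card_univ, hV]
  have lower (v : V) : 3 * m + 10 ≤ 3 * (∑ u, μ v u) + 5 * D := by
    have h := sum_le_sum fun u (hu : u ∈ univ.erase v) => hshare v u (ne_of_mem_erase hu).symm
    simp only [sum_add_distrib, sum_const, card_others, smul_eq_mul] at h
    have hμ := sum_others (μ v) v
    have hd := sum_others (fun u => ∑ w, μ u w) v
    have h0 := hloop v
    lia
  refine fun v => ⟨lower v, ?_⟩
  have h := sum_le_sum fun u (_ : u ∈ univ.erase v) => lower u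
  simp only [sum_add_distrib, sum_const, card_others, smul_eq_mul, ← mul_sum] at h
  have hd := sum_others (fun u => ∑ w, μ u w) v
  lia
end

section
/- Let D be an integer with D ≥ 3292872, and let H be a finite multigraph given by a vertex set V with |V| = 6 and a symmetric function μ : V × V → ℕ with μ(v,v) = 0 for all v; write d(v) = Σ_{u∈V} μ(v,u) and let m be the number of edges (2m = Σ_{(u,v)∈V×V} μ(u,v)). Assume: (i) d(v) ≤ D for every v ∈ V; (ii) 5D − 120 < 2m ≤ 5D; (iii) μ(u,v) ≥ 1 for all distinct u,v ∈ V (the underlying simple graph is complete); and (iv) for all distinct u,v, m − (d(u) + d(v) − μ(u,v)) ≤ D − 2. Then for all distinct u, v ∈ V: 3·μ(u,v) ≥ 87m − 217D + 374; furthermore, 6·μ(u,v) > D − 12000 (i.e., μ(u,v) > D/6 − 2000). -/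
open scoped Classical
open Finset

theorem multigraph_complete_multiplicity_bounds (D : ℕ) (hD : 3292872 ≤ D)
    {V : Type*} [Fintype V] (hV : Fintype.card V = 6) (μ : V → V → ℕ)
    (hsymm : ∀ u v, μ u v = μ v u) (hloop : ∀ v, μ v v = 0)
    (m : ℕ) (hm : 2 * m = ∑ u, ∑ v, μ u v)
    -- (i) every vertex has degree at most D
    (hdegD : ∀ v, ∑ u, μ v u ≤ D)
    -- (ii) 5D − 120 < 2m ≤ 5D
    (hm_lb : 5 * D < 2 * m + 120) (hm_ub : 2 * m ≤ 5 * D)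
    -- (iii) the underlying simple graph is complete
    (hcomplete : ∀ u v : V, u ≠ v → 1 ≤ μ u v)
    -- (iv) m − (d(u) + d(v) − μ(u,v)) ≤ D − 2 for all distinct u, v
    (hshare : ∀ u v : V, u ≠ v →
      m + μ u v + 2 ≤ D + ((∑ w, μ u w) + (∑ w, μ v w))) :
    ∀ u v : V, u ≠ v →
      -- 3·μ(u,v) ≥ 87m − 217D + 374
      87 * m + 374 ≤ 3 * μ u v + 217 * D ∧
      -- μ(u,v) > D/6 − 2000, i.e. 6·μ(u,v) > D − 12000
      D < 6 * μ u v + 12000 := by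
  intro u v huv
  set d : V → ℤ := fun a => ∑ b, (μ a b : ℤ) with hd
  set s : V → V → ℤ := fun a b => D - 2 + d a + d b - m - μ a b with hs
  have hsum : ∑ a, d a = 2 * m := by
    simp only [hd]
    exact_mod_cast hm.symm
  have hs_nonneg : ∀ a b, a ≠ b → 0 ≤ s a b := by
    intro a b hab
    have h : (m : ℤ) + μ a b + 2 ≤ D + (d a + d b) := by
      simp only [hd]
      exact_mod_cast hshare a b hab
    simp only [hs]
    linarith
  have hs_symm : s v u = s u v := by
    simp only [hs, hsymm v u]
    ring
  set S : V → ℤ := fun a => ∑ b ∈ univ.erase a, s a b with hS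
  have hS_eq : ∀ a, S a = 5 * (D - 2) + 3 * d a - 3 * m := by
    intro a
    have hrow : ∑ b, (μ a b : ℤ) = d a := rfl
    simp only [hS]
    rw [sum_erase_eq_sub (mem_univ a)]
    simp only [hs, sum_sub_distrib, sum_add_distrib, sum_const, card_univ, hV, hsum, hrow,
      hloop, nsmul_eq_mul]
    push_cast
    ring
  have hS_nonneg : ∀ a, 0 ≤ S a := fun a =>
    sum_nonneg fun b hb => hs_nonneg a b (ne_of_mem_erase hb).symm
  have hS_ge : ∀ a b, a ≠ b → s a b ≤ S a := fun a b hab =>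
    single_le_sum (f := s a) (fun c hc => hs_nonneg a c (ne_of_mem_erase hc).symm)
      (mem_erase.2 ⟨hab.symm, mem_univ b⟩)
  have hS_total : ∑ a, S a = 30 * (D - 2) - 12 * m := by
    simp only [hS_eq, sum_sub_distrib, sum_add_distrib, ← mul_sum, hsum, sum_const, card_univ,
      hV, nsmul_eq_mul]
    push_cast
    ring
  have hS_pair : S u + S v ≤ ∑ a, S a := by
    rw [← sum_pair huv]
    exact sum_le_sum_of_subset_of_nonneg (subset_univ _) fun a _ _ => hS_nonneg a
  have hu := hS_ge u v huv
  have hv := hS_ge v u huv.symm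
  have hnn := hs_nonneg u v huv
  have hSu := hS_eq u
  have hSv := hS_eq v
  have hsuv : s u v = D - 2 + d u + d v - m - μ u v := rfl
  rw [hs_symm] at hv
  constructor <;> omega
end

section
/- Let J be a finite simple bipartite graph with bipartition (A, T), where |T| = 6 and every edge of J has one endpoint in A and one endpoint in T, and suppose J is 2-degenerate. For i ∈ {1,2,3}, let Q_i = {a ∈ A : deg_J(a) ≥ i + 2}. Then: (1) |Q_1| ≤ 8, and if |Q_1| = 8 then every a ∈ A has deg_J(a) ≤ 3; (2) |Q_2| ≤ 4, and if |Q_2| = 4 then every a ∈ A has deg_J(a) ≤ 4; and (3) |Q_3| ≤ 2. -/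
open scoped Classical
open Finset

/-- A graph is 2-degenerate if every nonempty (induced) subgraph has a vertex
of degree at most 2 within it. -/
def SimpleGraph.TwoDegenerate {V : Type*} (G : SimpleGraph V) : Prop :=
  ∀ s : Finset V, s.Nonempty → ∃ v ∈ s, (s.filter (fun u => G.Adj v u)).card ≤ 2

/-- Any three vertices of a triangle-free 2-degenerate graph span at most two edges, so every set
of `n ≥ 3` vertices spans at most `2 n - 4` edges (each edge is counted twice below). -/
theorem SimpleGraph.TwoDegenerate.sum_adj_add_eight_le {V : Type*} {G : SimpleGraph V}
    (hdeg : G.TwoDegenerate) (htri : ∀ x y z, G.Adj x y → G.Adj y z → ¬ G.Adj x z)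
    (s : Finset V) (hs : 3 ≤ s.card) :
    (∑ u ∈ s, ∑ v ∈ s, if G.Adj u v then 1 else 0) + 8 ≤ 4 * s.card := by
  obtain ⟨n, hn⟩ : ∃ n, s.card = n + 3 := ⟨s.card - 3, by omega⟩
  clear hs
  induction n generalizing s with
  | zero =>
    obtain ⟨x, y, z, hxy, hxz, hyz, rfl⟩ := Finset.card_eq_three.mp (by simpa using hn)
    have h := htri x y z
    simp only [Finset.sum_insert, Finset.mem_insert, Finset.mem_singleton, hxy, hxz, hyz,
      or_self, not_false_eq_true, Finset.sum_singleton, G.adj_comm y x, G.adj_comm z x,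
      G.adj_comm z y, SimpleGraph.irrefl, if_false, hn]
    by_cases h₁ : G.Adj x y <;> by_cases h₂ : G.Adj y z <;> by_cases h₃ : G.Adj x z <;>
      simp_all
  | succ n ih =>
    obtain ⟨v, hv, hle⟩ := hdeg s (Finset.card_pos.mp (by omega))
    have hcard := Finset.card_erase_add_one hv
    have h := ih (s.erase v) (by omega)
    have hsplit (f : V → ℕ) : ∑ u ∈ s, f u = f v + ∑ u ∈ s.erase v, f u :=
      (Finset.add_sum_erase s f hv).symm
    rw [Finset.card_filter, hsplit] at hle
    simp only [hsplit, Finset.sum_add_distrib]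
    simp only [G.adj_comm _ v, SimpleGraph.irrefl, if_false] at hle ⊢
    omega

/-- In a 2-degenerate graph with bipartition `(A, T)`, the degrees of the vertices of a set
`R ⊆ A` sum to at most `2 (|R| + |T|) - 4`. -/
theorem SimpleGraph.TwoDegenerate.sum_degree_add_four_le {V : Type*} [Fintype V]
    {J : SimpleGraph V} {A T R : Finset V} (hdeg : J.TwoDegenerate) (hdisj : Disjoint A T)
    (hbip : ∀ u v : V, J.Adj u v → (u ∈ A ∧ v ∈ T) ∨ (u ∈ T ∧ v ∈ A))
    (hT : 3 ≤ T.card) (hR : R ⊆ A) :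
    ∑ a ∈ R, J.degree a + 4 ≤ 2 * (R.card + T.card) := by
  have hAT {x : V} (hA : x ∈ A) (hT : x ∈ T) : False := Finset.disjoint_left.mp hdisj hA hT
  have htri (x y z : V) (hxy : J.Adj x y) (hyz : J.Adj y z) : ¬ J.Adj x z := by
    intro hxz
    rcases hbip x y hxy with h₁ | h₁ <;> rcases hbip y z hyz with h₂ | h₂ <;>
      rcases hbip x z hxz with h₃ | h₃ <;>
      first
      | exact hAT h₁.1 h₃.1
      | exact hAT h₃.1 h₁.1
      | exact hAT h₂.1 h₁.2
      | exact hAT h₁.2 h₂.1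
      | exact hAT h₂.2 h₃.2
      | exact hAT h₃.2 h₂.2
  have hRT : Disjoint R T := Finset.disjoint_of_subset_left hR hdisj
  have hcard := Finset.card_union_of_disjoint hRT
  have h := hdeg.sum_adj_add_eight_le htri (R ∪ T) (by omega)
  simp only [Finset.sum_union hRT, Finset.sum_add_distrib] at h
  have hcomm : (∑ u ∈ T, ∑ v ∈ R, if J.Adj u v then 1 else 0) =
      ∑ u ∈ R, ∑ v ∈ T, if J.Adj u v then 1 else 0 := by
    rw [Finset.sum_comm]
    simp only [J.adj_comm]
  have hsum : ∑ a ∈ R, J.degree a = ∑ u ∈ R, ∑ v ∈ T, if J.Adj u v then 1 else 0 := by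
    refine Finset.sum_congr rfl fun a ha => ?_
    rw [← Finset.card_filter, ← J.card_neighborFinset_eq_degree]
    congr 1
    ext v
    simp only [SimpleGraph.mem_neighborFinset, Finset.mem_filter]
    refine ⟨fun hav => ⟨?_, hav⟩, fun hv => hv.2⟩
    rcases hbip a v hav with h' | h'
    · exact h'.2
    · exact (hAT (hR ha) h'.1).elim
  omega

theorem bipartite_two_degenerate_high_degree_counts
    {V : Type*} [Fintype V] (J : SimpleGraph V)
    (A T : Finset V) (hdisj : Disjoint A T) (hunion : A ∪ T = Finset.univ)
    (hT : T.card = 6)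
    (hbip : ∀ u v : V, J.Adj u v → (u ∈ A ∧ v ∈ T) ∨ (u ∈ T ∧ v ∈ A))
    (hdeg : J.TwoDegenerate) :
    ((A.filter (fun a => 3 ≤ J.degree a)).card ≤ 8 ∧
      ((A.filter (fun a => 3 ≤ J.degree a)).card = 8 → ∀ a ∈ A, J.degree a ≤ 3)) ∧
    ((A.filter (fun a => 4 ≤ J.degree a)).card ≤ 4 ∧
      ((A.filter (fun a => 4 ≤ J.degree a)).card = 4 → ∀ a ∈ A, J.degree a ≤ 4)) ∧
    (A.filter (fun a => 5 ≤ J.degree a)).card ≤ 2 := by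
  have hbound (k : ℕ) := hdeg.sum_degree_add_four_le hdisj hbip (by omega)
    (Finset.filter_subset (fun a => k ≤ J.degree a) A)
  have hlow (k : ℕ) : k * (A.filter (fun a => k ≤ J.degree a)).card ≤
      ∑ a ∈ A.filter (fun a => k ≤ J.degree a), J.degree a := by
    rw [mul_comm, ← smul_eq_mul]
    exact Finset.card_nsmul_le_sum _ _ _ fun a ha => (Finset.mem_filter.mp ha).2
  have hlow_strict (k : ℕ) (a : V) (ha : a ∈ A) (hka : k < J.degree a) :
      k * (A.filter (fun a => k ≤ J.degree a)).card <
        ∑ a ∈ A.filter (fun a => k ≤ J.degree a), J.degree a := by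
    rw [mul_comm, ← smul_eq_mul, ← Finset.sum_const]
    exact Finset.sum_lt_sum (fun b hb => (Finset.mem_filter.mp hb).2)
      ⟨a, Finset.mem_filter.mpr ⟨ha, hka.le⟩, hka⟩
  have h₃ := hbound 3
  have h₄ := hbound 4
  have h₅ := hbound 5
  have l₃ := hlow 3
  have l₄ := hlow 4
  have l₅ := hlow 5
  refine ⟨⟨by omega, fun hc a ha => ?_⟩, ⟨by omega, fun hc a ha => ?_⟩, by omega⟩
  · by_contra! hlt
    have := hlow_strict 3 a ha hlt
    omega
  · by_contra! hlt
    have := hlow_strict 4 a ha hlt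
    omega
end
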